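/- Let X be the 2×2 complex 'covariance' matrix [[0, −i],[−i, 0]] and let the pair (α, β) have the formal Gaussian moments ⟨αβ⟩ = −i, ⟨α²⟩ = ⟨β²⟩ = 0 arising from the change of variables α = (a+b)/√2, β = (a−b)/√2 where a has imaginary Gaussian covariance −i and b has covariance +i. Then for complex numbers A, B, C, D the pair integral satisfies ∫ exp(i(Aα + Bβ + Cᾱ + Dβ̄)) dμ^c_X(α, β) = exp(i(AD + BC)). -/

import Mathlib

open MeasureTheory Real Complex

/-- Deformed contour for covariance `−i`: `x ↦ x − iε tanh x`. -/
noncomputable def ctrM (ε x : ℝ) : ℂ := x - Complex.I * ε * Real.tanh x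

/-- Deformed contour for covariance `+i`: `x ↦ x + iε tanh x`. -/
noncomputable def ctrP (ε x : ℝ) : ℂ := x + Complex.I * ε * Real.tanh x

/-- Derivative of `ctrM`. -/
noncomputable def ctrMDeriv (ε x : ℝ) : ℂ := 1 - Complex.I * ε * (1 - Real.tanh x ^ 2)

/-- Derivative of `ctrP`. -/
noncomputable def ctrPDeriv (ε x : ℝ) : ℂ := 1 + Complex.I * ε * (1 - Real.tanh x ^ 2)

/-- The point with real part `x` and imaginary part `-s ε y`. -/
noncomputable def tiltedPoint (s ε x y : ℝ) : ℂ := x - s * Complex.I * ε * y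

/-- The oscillatory Gaussian `exp (-s i z² + i k z)`. -/
noncomputable def oscGaussian (s : ℝ) (k z : ℂ) : ℂ :=
  Complex.exp (-(s * Complex.I) * z ^ 2 + Complex.I * k * z)

/-- The oscillatory Gaussian pulled back along the contour `x ↦ x - s i ε tanh x`. -/
noncomputable def contourIntegrand (s ε : ℝ) (k : ℂ) (x : ℝ) : ℂ :=
  oscGaussian s k (tiltedPoint s ε x (Real.tanh x)) *
    (1 - s * Complex.I * ε * (1 - Real.tanh x ^ 2 : ℝ))

/-- The oscillatory Gaussian pulled back along the line `x ↦ x - s i ε x`. -/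
noncomputable def lineIntegrand (s ε : ℝ) (k : ℂ) (x : ℝ) : ℂ :=
  oscGaussian s k (tiltedPoint s ε x x) * (1 - s * Complex.I * ε)

theorem Real.hasDerivAt_tanh_one_sub_sq (x : ℝ) :
    HasDerivAt Real.tanh (1 - Real.tanh x ^ 2) x := by
  have h := (Real.hasDerivAt_sinh x).div (Real.hasDerivAt_cosh x) (Real.cosh_pos x).ne'
  have e : Real.tanh = fun y => Real.sinh y / Real.cosh y :=
    funext Real.tanh_eq_sinh_div_cosh
  rw [e]
  refine h.congr_deriv ?_
  have := (Real.cosh_pos x).ne'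
  field_simp

theorem Real.continuous_tanh_of_deriv : Continuous Real.tanh :=
  continuous_iff_continuousAt.2 fun x => (Real.hasDerivAt_tanh_one_sub_sq x).continuousAt

theorem Real.sub_one_le_mul_tanh (x : ℝ) : x - 1 ≤ x * Real.tanh x := by
  have h1 : 2 * x + 1 ≤ Real.exp x * Real.exp x := by
    rw [← Real.exp_add, ← two_mul]; exact Real.add_one_le_exp _
  have h2 : Real.exp x * Real.exp (-x) = 1 := by rw [← Real.exp_add]; simp
  have p1 := Real.exp_pos x
  have p2 := Real.exp_pos (-x)
  rw [Real.tanh_eq, ← mul_div_assoc, le_div_iff₀ (by positivity)]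
  have h3 : (2 * x + 1) * Real.exp (-x) ≤ Real.exp x := by
    calc _ ≤ Real.exp x * Real.exp x * Real.exp (-x) := by gcongr
      _ = Real.exp x := by rw [mul_assoc, h2, mul_one]
  nlinarith

theorem Real.abs_sub_one_le_mul_tanh (x : ℝ) : |x| - 1 ≤ x * Real.tanh x := by
  rcases le_total 0 x with h | h
  · rw [abs_of_nonneg h]; exact Real.sub_one_le_mul_tanh x
  · have := Real.sub_one_le_mul_tanh (-x)
    rw [Real.tanh_neg] at this
    rw [abs_of_nonpos h]; linarith

theorem integrable_exp_neg_mul_abs {δ : ℝ} (hδ : 0 < δ) :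
    Integrable fun x : ℝ => Real.exp (-δ * |x|) := by
  refine (integrable_inv_one_add_sq.comp_mul_left' (R := δ / 2) (by positivity)).mono'
    (by fun_prop) (.of_forall fun x => ?_)
  rw [Real.norm_of_nonneg (Real.exp_pos _).le, neg_mul, Real.exp_neg]
  have h := Real.quadratic_le_exp_of_nonneg (x := δ * |x|) (by positivity)
  have h1 : (0 : ℝ) ≤ δ * |x| := by positivity
  have h2 : (δ * |x|) ^ 2 = δ ^ 2 * x ^ 2 := by rw [mul_pow, sq_abs]
  refine inv_anti₀ (by positivity) ?_
  nlinarith [mul_nonneg (sq_nonneg δ) (sq_nonneg x)]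

theorem norm_oscGaussian_tiltedPoint_le {s ε : ℝ} (hs : s * s = 1) (hε : 0 < ε) (k : ℂ)
    (x y : ℝ) :
    ‖oscGaussian s k (tiltedPoint s ε x y)‖ ≤
      Real.exp (-2 * ε * (x * y) + ‖k‖ * |x| + ‖k‖ * ε * |y|) := by
  rw [oscGaussian, Complex.norm_exp, Real.exp_le_exp]
  have hs1 : |s| = 1 := by
    rcases mul_self_eq_one_iff.1 hs with h | h <;> simp [h]
  have e : (-(s * Complex.I) * tiltedPoint s ε x y ^ 2 +
      Complex.I * k * tiltedPoint s ε x y).re =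
      -2 * ε * (s * s) * (x * y) + -(k.im * x) + s * (k.re * ε * y) := by
    simp [tiltedPoint, pow_two]; ring
  rw [e, hs]
  have h1 : -(k.im * x) ≤ ‖k‖ * |x| := by
    refine (neg_le_abs _).trans ?_
    rw [abs_mul]; gcongr; exact Complex.abs_im_le_norm k
  have h2 : s * (k.re * ε * y) ≤ ‖k‖ * ε * |y| := by
    refine (le_abs_self _).trans ?_
    rw [abs_mul, abs_mul, abs_mul, hs1, one_mul, abs_of_pos hε]
    gcongr; exact Complex.abs_re_le_norm k
  linarith

/-- Uniform exponential decay on the segments joining the `tanh` contour to the line. -/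
theorem norm_oscGaussian_tiltedPoint_le_exp_neg {s ε : ℝ} (hs : s * s = 1) (hε : 0 < ε) (k : ℂ)
    {x y : ℝ} (hx : ‖k‖ ≤ 2 * |x|) (hxy : x * y = |x| * |y|) (hy : |Real.tanh x| ≤ |y|) :
    ‖oscGaussian s k (tiltedPoint s ε x y)‖ ≤
      Real.exp ((2 + ‖k‖) * ε) * Real.exp (-(2 * ε - ‖k‖) * |x|) := by
  refine (norm_oscGaussian_tiltedPoint_le hs hε k x y).trans ?_
  rw [← Real.exp_add, Real.exp_le_exp, hxy]
  have h1 : |x| - 1 ≤ |x| * |Real.tanh x| := by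
    rw [← abs_mul]; exact (Real.abs_sub_one_le_mul_tanh x).trans (le_abs_self _)
  have h2 := (Real.abs_tanh_lt_one x).le
  have h3 : ε * (2 * |x| - ‖k‖) * |Real.tanh x| ≤ ε * (2 * |x| - ‖k‖) * |y| :=
    mul_le_mul_of_nonneg_left hy (mul_nonneg hε.le (by linarith))
  have h4 := mul_le_mul_of_nonneg_left h1 hε.le
  have h5 := mul_le_mul_of_nonneg_left h2 (mul_nonneg (norm_nonneg k) hε.le)
  nlinarith

theorem continuous_contourIntegrand (s ε : ℝ) (k : ℂ) : Continuous (contourIntegrand s ε k) := by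
  have := Real.continuous_tanh_of_deriv
  unfold contourIntegrand oscGaussian tiltedPoint
  fun_prop

theorem continuous_lineIntegrand (s ε : ℝ) (k : ℂ) : Continuous (lineIntegrand s ε k) := by
  unfold lineIntegrand oscGaussian tiltedPoint
  fun_prop

theorem integrable_contourIntegrand {s ε : ℝ} (hs : s * s = 1) (hε : 0 < ε) {k : ℂ}
    (hk : ‖k‖ < 2 * ε) : Integrable (contourIntegrand s ε k) := by
  have hs1 : |s| = 1 := by
    rcases mul_self_eq_one_iff.1 hs with h | h <;> simp [h]
  refine ((integrable_exp_neg_mul_abs (sub_pos.2 hk)).const_mul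
    (Real.exp ((2 + ‖k‖) * ε) * (1 + ε))).mono'
    (continuous_contourIntegrand s ε k).aestronglyMeasurable (.of_forall fun x => ?_)
  rw [contourIntegrand, norm_mul]
  have h1 : ‖oscGaussian s k (tiltedPoint s ε x (Real.tanh x))‖ ≤
      Real.exp ((2 + ‖k‖) * ε) * Real.exp (-(2 * ε - ‖k‖) * |x|) := by
    refine (norm_oscGaussian_tiltedPoint_le hs hε k x _).trans ?_
    rw [← Real.exp_add, Real.exp_le_exp]
    have h2 := mul_le_mul_of_nonneg_left (Real.abs_tanh_lt_one x).le
      (mul_nonneg (norm_nonneg k) hε.le)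
    have h3 := mul_le_mul_of_nonneg_left (Real.abs_sub_one_le_mul_tanh x) hε.le
    nlinarith
  have h2 : ‖1 - s * Complex.I * ε * (1 - Real.tanh x ^ 2 : ℝ)‖ ≤ 1 + ε := by
    refine (norm_sub_le _ _).trans ?_
    have h3 : |1 - Real.tanh x ^ 2| ≤ 1 := by
      have := Real.tanh_sq_lt_one x
      rw [abs_le]; constructor <;> nlinarith [sq_nonneg (Real.tanh x)]
    rw [norm_one, norm_mul, norm_mul, norm_mul, Complex.norm_real, Complex.norm_real,
      Complex.norm_real, Complex.norm_I, Real.norm_eq_abs, Real.norm_eq_abs, Real.norm_eq_abs,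
      hs1, abs_of_pos hε]
    nlinarith
  calc _ ≤ Real.exp ((2 + ‖k‖) * ε) * Real.exp (-(2 * ε - ‖k‖) * |x|) * (1 + ε) := by gcongr
    _ = _ := by ring

theorem lineIntegrand_eq (s ε : ℝ) (k : ℂ) (x : ℝ) :
    lineIntegrand s ε k x = Complex.exp (-(s * Complex.I * (1 - s * Complex.I * ε) ^ 2) * x ^ 2 +
      Complex.I * k * (1 - s * Complex.I * ε) * x + 0) * (1 - s * Complex.I * ε) := by
  rw [lineIntegrand, oscGaussian, tiltedPoint]
  congr 2
  ring

theorem re_line_coefficient {s : ℝ} (hs : s * s = 1) (ε : ℝ) :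
    (s * Complex.I * (1 - s * Complex.I * ε) ^ 2).re = 2 * ε := by
  have : (s * Complex.I * (1 - s * Complex.I * ε) ^ 2).re = 2 * ε * (s * s) := by
    simp [pow_two]; ring
  rw [this, hs, mul_one]

theorem integrable_lineIntegrand {s ε : ℝ} (hs : s * s = 1) (hε : 0 < ε) (k : ℂ) :
    Integrable (lineIntegrand s ε k) := by
  simp_rw [funext (lineIntegrand_eq s ε k)]
  refine (integrable_cexp_quadratic ?_ _ _).mul_const _
  rw [re_line_coefficient hs]; positivity

theorem exists_integral_lineIntegrand {s ε : ℝ} (hs : s * s = 1) (hε : 0 < ε) :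
    ∃ c : ℂ, c ^ 2 = Real.pi / (s * Complex.I) ∧
      ∀ k : ℂ, ∫ x, lineIntegrand s ε k x = c * Complex.exp (s * Complex.I * k ^ 2 / 4) := by
  set w : ℂ := 1 - s * Complex.I * ε with hw
  have hre := re_line_coefficient hs ε
  have hb : s * Complex.I * w ^ 2 ≠ 0 := fun h => by
    rw [← hw, h] at hre; simp at hre; linarith
  have hsI : (s : ℂ) * Complex.I ≠ 0 := left_ne_zero_of_mul hb
  have hw0 : w ≠ 0 := fun h => by simp [h] at hb
  have hsC : (s : ℂ) * s = 1 := by exact_mod_cast hs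
  refine ⟨(Real.pi / (s * Complex.I * w ^ 2)) ^ (1 / 2 : ℂ) * w, ?_, fun k => ?_⟩
  · rw [mul_pow, ← Complex.cpow_nat_mul]
    norm_num
    field_simp
  · simp_rw [funext (lineIntegrand_eq s ε k)]
    rw [integral_mul_const, integral_cexp_quadratic (by rw [Complex.neg_re, hre]; linarith),
      neg_neg]
    have e : 0 - (Complex.I * k * w) ^ 2 / (4 * -(s * Complex.I * w ^ 2)) =
        s * Complex.I * k ^ 2 / 4 := by
      have hs0 : (s : ℂ) ≠ 0 := left_ne_zero_of_mul hsI
      field_simp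
      linear_combination -(Complex.I * k ^ 2) * hsC
    rw [← hw, e]; ring

theorem integral_contourIntegrand_eq_integral_lineIntegrand {s ε : ℝ} (hs : s * s = 1)
    (hε : 0 < ε) {k : ℂ} (hk : ‖k‖ < 2 * ε) :
    ∫ x, contourIntegrand s ε k x = ∫ x, lineIntegrand s ε k x := by
  obtain ⟨G, hG⟩ := Differentiable.isExactOn_univ (f := oscGaussian s k)
    (by unfold oscGaussian; fun_prop)
  replace hG : ∀ z, HasDerivAt G (oscGaussian s k z) z := fun z => hG z trivial
  have hs1 : |s| = 1 := by
    rcases mul_self_eq_one_iff.1 hs with h | h <;> simp [h]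
  set E : ℝ → ℂ := fun x => G (tiltedPoint s ε x (Real.tanh x)) - G (tiltedPoint s ε x x) with hE
  have ftc1 : ∀ a b : ℝ, ∫ x in a..b, contourIntegrand s ε k x =
      G (tiltedPoint s ε b (Real.tanh b)) - G (tiltedPoint s ε a (Real.tanh a)) := fun a b => by
    refine intervalIntegral.integral_eq_sub_of_hasDerivAt
      (f := fun x => G (tiltedPoint s ε x (Real.tanh x))) (fun x _ => ?_)
      ((continuous_contourIntegrand s ε k).intervalIntegrable _ _)
    have h : HasDerivAt (fun x : ℝ => tiltedPoint s ε x (Real.tanh x))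
        (1 - s * Complex.I * ε * (1 - Real.tanh x ^ 2 : ℝ)) x :=
      (hasDerivAt_id x).ofReal_comp.sub
        ((Real.hasDerivAt_tanh_one_sub_sq x).ofReal_comp.const_mul _)
    exact (hG _).comp x h
  have ftc2 : ∀ a b : ℝ, ∫ x in a..b, lineIntegrand s ε k x =
      G (tiltedPoint s ε b b) - G (tiltedPoint s ε a a) := fun a b => by
    refine intervalIntegral.integral_eq_sub_of_hasDerivAt
      (f := fun x => G (tiltedPoint s ε x x)) (fun x _ => ?_)
      ((continuous_lineIntegrand s ε k).intervalIntegrable _ _)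
    have h : HasDerivAt (fun x : ℝ => tiltedPoint s ε x x) (1 - s * Complex.I * ε) x := by
      have h1 : HasDerivAt (fun x : ℝ => (x : ℂ)) 1 x := (hasDerivAt_id x).ofReal_comp
      exact (h1.sub (h1.const_mul (s * Complex.I * ε))).congr_deriv (by ring)
    exact (hG _).comp x h
  have bound : ∀ x : ℝ, 1 ≤ |x| → ‖k‖ ≤ 2 * |x| →
      ‖E x‖ ≤ Real.exp ((2 + ‖k‖) * ε) * Real.exp (-(2 * ε - ‖k‖) * |x|) * (ε * (2 * |x|)) := by
    intro x hx hkx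
    have ht := Real.abs_tanh_lt_one x
    have hxt : x * Real.tanh x = |x| * |Real.tanh x| := by
      rw [← abs_mul, abs_of_nonneg]
      linarith [Real.abs_sub_one_le_mul_tanh x]
    have hseg : ∀ z ∈ segment ℝ (tiltedPoint s ε x x) (tiltedPoint s ε x (Real.tanh x)),
        ‖oscGaussian s k z‖ ≤
          Real.exp ((2 + ‖k‖) * ε) * Real.exp (-(2 * ε - ‖k‖) * |x|) := by
      rintro z ⟨p, q, hp, hq, hpq, rfl⟩
      have ez : p • tiltedPoint s ε x x + q • tiltedPoint s ε x (Real.tanh x) =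
          tiltedPoint s ε x (p * x + q * Real.tanh x) := by
        have hC : (p : ℂ) + q = 1 := by exact_mod_cast hpq
        simp only [tiltedPoint, Complex.real_smul]
        push_cast
        linear_combination (x : ℂ) * hC
      rw [ez]
      have hxy : x * (p * x + q * Real.tanh x) = |x| * (p * |x| + q * |Real.tanh x|) := by
        have := abs_mul_abs_self x
        linear_combination q * hxt - p * this
      have hnn : 0 ≤ p * |x| + q * |Real.tanh x| := by positivity
      have hy : |p * x + q * Real.tanh x| = p * |x| + q * |Real.tanh x| := by
        have h := congrArg abs hxy
        rw [abs_mul, abs_mul, abs_abs, abs_of_nonneg hnn] at h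
        exact mul_left_cancel₀ (by positivity) h
      refine norm_oscGaussian_tiltedPoint_le_exp_neg hs hε k hkx (by rw [hxy, hy]) ?_
      rw [hy]
      have : p * |Real.tanh x| ≤ p * |x| :=
        mul_le_mul_of_nonneg_left (ht.le.trans hx) hp
      nlinarith
    refine (Convex.norm_image_sub_le_of_norm_hasDerivWithin_le
      (fun z _ => (hG z).hasDerivWithinAt) hseg (convex_segment _ _)
      (left_mem_segment ℝ _ _) (right_mem_segment ℝ _ _)).trans ?_
    gcongr
    have e : tiltedPoint s ε x (Real.tanh x) - tiltedPoint s ε x x =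
        s * Complex.I * ε * (x - Real.tanh x : ℝ) := by
      simp only [tiltedPoint]; push_cast; ring
    rw [e, norm_mul, norm_mul, norm_mul, Complex.norm_real, Complex.norm_real,
      Complex.norm_real, Complex.norm_I, Real.norm_eq_abs, Real.norm_eq_abs, Real.norm_eq_abs,
      hs1, abs_of_pos hε, one_mul, one_mul]
    gcongr
    linarith [abs_sub x (Real.tanh x)]
  have decay : Filter.Tendsto (fun R : ℝ => Real.exp ((2 + ‖k‖) * ε) *
      Real.exp (-(2 * ε - ‖k‖) * R) * (ε * (2 * R))) Filter.atTop (nhds 0) := by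
    have h := (tendsto_rpow_mul_exp_neg_mul_atTop_nhds_zero 1 (2 * ε - ‖k‖)
      (sub_pos.2 hk)).const_mul (Real.exp ((2 + ‖k‖) * ε) * ε * 2)
    rw [mul_zero] at h
    refine h.congr fun R => ?_
    rw [Real.rpow_one]
    ring
  have large : ∀ᶠ R : ℝ in Filter.atTop, 1 ≤ R ∧ ‖k‖ ≤ 2 * R := by
    filter_upwards [Filter.eventually_ge_atTop 1, Filter.eventually_ge_atTop ‖k‖] with R h1 h2
    exact ⟨h1, by linarith⟩
  have lim_pos : Filter.Tendsto E Filter.atTop (nhds 0) := by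
    refine squeeze_zero_norm' (large.mono fun R hR => ?_) decay
    have hR0 : |R| = R := abs_of_nonneg (by linarith)
    simpa only [hR0] using bound R (by rw [hR0]; exact hR.1) (by rw [hR0]; exact hR.2)
  have lim_neg : Filter.Tendsto (fun R => E (-R)) Filter.atTop (nhds 0) := by
    refine squeeze_zero_norm' (large.mono fun R hR => ?_) decay
    have hR0 : |-R| = R := by rw [abs_neg]; exact abs_of_nonneg (by linarith)
    simpa only [hR0] using bound (-R) (by rw [hR0]; exact hR.1) (by rw [hR0]; exact hR.2)
  have t1 := intervalIntegral_tendsto_integral (integrable_contourIntegrand hs hε hk)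
    Filter.tendsto_neg_atTop_atBot Filter.tendsto_id
  have t2 := intervalIntegral_tendsto_integral (integrable_lineIntegrand hs hε k)
    Filter.tendsto_neg_atTop_atBot Filter.tendsto_id
  have t3 := t2.add (lim_pos.sub lim_neg)
  rw [sub_zero, add_zero] at t3
  refine tendsto_nhds_unique t1 (t3.congr fun R => ?_)
  rw [ftc1, ftc2, hE]
  simp only [id]
  ring

theorem exists_integral_contourIntegrand {s ε : ℝ} (hs : s * s = 1) (hε : 0 < ε) :
    ∃ c : ℂ, c ^ 2 = Real.pi / (s * Complex.I) ∧ ∀ k : ℂ, ‖k‖ < 2 * ε →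
      ∫ x, contourIntegrand s ε k x = c * Complex.exp (s * Complex.I * k ^ 2 / 4) := by
  obtain ⟨c, hc, h⟩ := exists_integral_lineIntegrand hs hε
  exact ⟨c, hc, fun k hk =>
    (integral_contourIntegrand_eq_integral_lineIntegrand hs hε hk).trans (h k)⟩

theorem contour_product_eq (A B C D r : ℂ) (ε xa ya xb yb : ℝ) :
    (1 / (-Complex.I * Real.pi)) * (1 / (Complex.I * Real.pi)) *
        Complex.exp (-((ctrM ε xa) ^ 2 + (ctrM ε ya) ^ 2) / (-Complex.I)) *
        Complex.exp (-((ctrP ε xb) ^ 2 + (ctrP ε yb) ^ 2) / Complex.I) *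
        ctrMDeriv ε xa * ctrMDeriv ε ya * ctrPDeriv ε xb * ctrPDeriv ε yb *
        Complex.exp (Complex.I *
          (A * ((ctrM ε xa + Complex.I * ctrM ε ya + (ctrP ε xb + Complex.I * ctrP ε yb)) / r) +
           B * ((ctrM ε xa + Complex.I * ctrM ε ya - (ctrP ε xb + Complex.I * ctrP ε yb)) / r) +
           C * ((ctrM ε xa - Complex.I * ctrM ε ya + (ctrP ε xb - Complex.I * ctrP ε yb)) / r) +
           D * ((ctrM ε xa - Complex.I * ctrM ε ya - (ctrP ε xb - Complex.I * ctrP ε yb)) / r))) =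
      (1 / (-Complex.I * Real.pi)) * (1 / (Complex.I * Real.pi)) *
        (contourIntegrand 1 ε ((A + B + C + D) / r) xa *
        (contourIntegrand 1 ε (Complex.I * (A + B - C - D) / r) ya *
          (contourIntegrand (-1) ε ((A - B + C - D) / r) xb *
            contourIntegrand (-1) ε (Complex.I * (A - B - C + D) / r) yb))) := by
  have hM : ∀ x, tiltedPoint 1 ε x (Real.tanh x) = ctrM ε x := fun x => by
    simp [tiltedPoint, ctrM]
  have hP : ∀ x, tiltedPoint (-1) ε x (Real.tanh x) = ctrP ε x := fun x => by
    simp [tiltedPoint, ctrP]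
  have hM' : ∀ x, 1 - ((1 : ℝ) : ℂ) * Complex.I * ε * (1 - Real.tanh x ^ 2 : ℝ) =
      ctrMDeriv ε x := fun x => by simp [ctrMDeriv]
  have hP' : ∀ x, 1 - ((-1 : ℝ) : ℂ) * Complex.I * ε * (1 - Real.tanh x ^ 2 : ℝ) =
      ctrPDeriv ε x := fun x => by simp [ctrPDeriv]
  simp only [contourIntegrand, hM, hP, hM', hP', oscGaussian]
  generalize ctrM ε xa = u
  generalize ctrM ε ya = v
  generalize ctrP ε xb = w
  generalize ctrP ε yb = z
  have key : Complex.exp (-(u ^ 2 + v ^ 2) / (-Complex.I)) *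
      Complex.exp (-(w ^ 2 + z ^ 2) / Complex.I) *
      Complex.exp (Complex.I *
          (A * ((u + Complex.I * v + (w + Complex.I * z)) / r) +
           B * ((u + Complex.I * v - (w + Complex.I * z)) / r) +
           C * ((u - Complex.I * v + (w - Complex.I * z)) / r) +
           D * ((u - Complex.I * v - (w - Complex.I * z)) / r))) =
      Complex.exp (-(((1 : ℝ) : ℂ) * Complex.I) * u ^ 2 +
        Complex.I * ((A + B + C + D) / r) * u) *
      Complex.exp (-(((1 : ℝ) : ℂ) * Complex.I) * v ^ 2 +
        Complex.I * (Complex.I * (A + B - C - D) / r) * v) *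
      Complex.exp (-(((-1 : ℝ) : ℂ) * Complex.I) * w ^ 2 +
        Complex.I * ((A - B + C - D) / r) * w) *
      Complex.exp (-(((-1 : ℝ) : ℂ) * Complex.I) * z ^ 2 +
        Complex.I * (Complex.I * (A - B - C + D) / r) * z) := by
    simp only [← Complex.exp_add]
    congr 1
    simp only [div_neg, Complex.div_I]
    push_cast
    ring
  linear_combination (1 / (-Complex.I * Real.pi)) * (1 / (Complex.I * Real.pi)) *
    ctrMDeriv ε xa * ctrMDeriv ε ya * ctrPDeriv ε xb * ctrPDeriv ε yb * key

/-- conjugate-pair imaginary Gaussian integral.  With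
`α = (a+b)/√2`, `β = (a−b)/√2` where `a` has imaginary Gaussian covariance `−i` and
`b` has covariance `+i` (realized by the regularized contour integrals, with formal
conjugates `ᾱ, β̄`), one has
`∫ exp(i(Aα + Bβ + Cᾱ + Dβ̄)) dμ^c_X(α, β) = exp(i(AD + BC))`,
the regularized integrals being absolutely convergent for `ε` large enough compared to
`|A|, |B|, |C|, |D|`. -/
theorem pair_imaginary_gaussian_exp (A B C D : ℂ) (ε : ℝ)
    (hε : ‖A‖ + ‖B‖ + ‖C‖ + ‖D‖ < ε) :
    letI a : ℝ → ℝ → ℂ := fun xa ya => ctrM ε xa + Complex.I * ctrM ε ya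
    letI abar : ℝ → ℝ → ℂ := fun xa ya => ctrM ε xa - Complex.I * ctrM ε ya
    letI b : ℝ → ℝ → ℂ := fun xb yb => ctrP ε xb + Complex.I * ctrP ε yb
    letI bbar : ℝ → ℝ → ℂ := fun xb yb => ctrP ε xb - Complex.I * ctrP ε yb
    letI F : ℝ × ℝ × ℝ × ℝ → ℂ := fun p =>
      let xa := p.1; let ya := p.2.1; let xb := p.2.2.1; let yb := p.2.2.2
      (1 / (-Complex.I * Real.pi)) * (1 / (Complex.I * Real.pi)) *
        Complex.exp (-((ctrM ε xa) ^ 2 + (ctrM ε ya) ^ 2) / (-Complex.I)) *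
        Complex.exp (-((ctrP ε xb) ^ 2 + (ctrP ε yb) ^ 2) / Complex.I) *
        ctrMDeriv ε xa * ctrMDeriv ε ya * ctrPDeriv ε xb * ctrPDeriv ε yb *
        Complex.exp (Complex.I *
          (A * ((a xa ya + b xb yb) / (Real.sqrt 2 : ℂ)) +
           B * ((a xa ya - b xb yb) / (Real.sqrt 2 : ℂ)) +
           C * ((abar xa ya + bbar xb yb) / (Real.sqrt 2 : ℂ)) +
           D * ((abar xa ya - bbar xb yb) / (Real.sqrt 2 : ℂ))))
    Integrable F ∧ ∫ p : ℝ × ℝ × ℝ × ℝ, F p = Complex.exp (Complex.I * (A * D + B * C)) := by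
  have hε0 : 0 < ε := lt_of_le_of_lt (by positivity) hε
  set r : ℂ := (Real.sqrt 2 : ℂ) with hr
  have hr2 : r ^ 2 = 2 := by
    rw [hr, ← Complex.ofReal_pow, Real.sq_sqrt (by norm_num)]; norm_num
  have hr0 : r ≠ 0 := fun h => by simp [h] at hr2
  have norm_lt : ∀ m : ℂ, ‖m‖ ≤ ‖A‖ + ‖B‖ + ‖C‖ + ‖D‖ → ‖m / r‖ < 2 * ε := fun m hm => by
    have h1 : (1 : ℝ) ≤ ‖r‖ := by
      rw [hr, Complex.norm_real, Real.norm_of_nonneg (Real.sqrt_nonneg _)]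
      exact Real.one_le_sqrt.2 (by norm_num)
    rw [norm_div]
    linarith [div_le_self (norm_nonneg m) h1]
  have n1 : ‖(A + B + C + D) / r‖ < 2 * ε := norm_lt _ (norm_add₄_le)
  have n2 : ‖Complex.I * (A + B - C - D) / r‖ < 2 * ε := norm_lt _ (by
    rw [norm_mul, Complex.norm_I, one_mul]
    simpa [sub_eq_add_neg] using norm_add₄_le (a := A) (b := B) (c := -C) (d := -D))
  have n3 : ‖(A - B + C - D) / r‖ < 2 * ε := norm_lt _ (by
    simpa [sub_eq_add_neg] using norm_add₄_le (a := A) (b := -B) (c := C) (d := -D))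
  have n4 : ‖Complex.I * (A - B - C + D) / r‖ < 2 * ε := norm_lt _ (by
    rw [norm_mul, Complex.norm_I, one_mul]
    simpa [sub_eq_add_neg] using norm_add₄_le (a := A) (b := -B) (c := -C) (d := D))
  have hp : (1 : ℝ) * 1 = 1 := by norm_num
  have hm : (-1 : ℝ) * (-1) = 1 := by norm_num
  obtain ⟨c, hc, ic⟩ := exists_integral_contourIntegrand hp hε0
  obtain ⟨d, hd, jd⟩ := exists_integral_contourIntegrand hm hε0
  have hint := ((integrable_contourIntegrand hp hε0 n1).mul_prod
    ((integrable_contourIntegrand hp hε0 n2).mul_prod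
      ((integrable_contourIntegrand hm hε0 n3).mul_prod
        (integrable_contourIntegrand hm hε0 n4)))).const_mul
          ((1 / (-Complex.I * Real.pi)) * (1 / (Complex.I * Real.pi)))
  have hval : ∫ p : ℝ × ℝ × ℝ × ℝ, (1 / (-Complex.I * Real.pi)) * (1 / (Complex.I * Real.pi)) *
      (contourIntegrand 1 ε ((A + B + C + D) / r) p.1 *
        (contourIntegrand 1 ε (Complex.I * (A + B - C - D) / r) p.2.1 *
          (contourIntegrand (-1) ε ((A - B + C - D) / r) p.2.2.1 *
            contourIntegrand (-1) ε (Complex.I * (A - B - C + D) / r) p.2.2.2))) =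
      Complex.exp (Complex.I * (A * D + B * C)) := by
    rw [integral_const_mul]
    simp only [Measure.volume_eq_prod]
    rw [integral_prod_mul (contourIntegrand 1 ε ((A + B + C + D) / r))
        (fun q : ℝ × ℝ × ℝ => contourIntegrand 1 ε (Complex.I * (A + B - C - D) / r) q.1 *
          (contourIntegrand (-1) ε ((A - B + C - D) / r) q.2.1 *
            contourIntegrand (-1) ε (Complex.I * (A - B - C + D) / r) q.2.2)),
      integral_prod_mul (contourIntegrand 1 ε (Complex.I * (A + B - C - D) / r))
        (fun q : ℝ × ℝ => contourIntegrand (-1) ε ((A - B + C - D) / r) q.1 *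
            contourIntegrand (-1) ε (Complex.I * (A - B - C + D) / r) q.2),
      integral_prod_mul, ic _ n1, ic _ n2, jd _ n3, jd _ n4]
    have e : Complex.I * (A * D + B * C) =
        ((1 : ℝ) : ℂ) * Complex.I * ((A + B + C + D) / r) ^ 2 / 4 +
        (((1 : ℝ) : ℂ) * Complex.I * (Complex.I * (A + B - C - D) / r) ^ 2 / 4 +
        (((-1 : ℝ) : ℂ) * Complex.I * ((A - B + C - D) / r) ^ 2 / 4 +
        ((-1 : ℝ) : ℂ) * Complex.I * (Complex.I * (A - B - C + D) / r) ^ 2 / 4)) := by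
      simp only [div_pow, mul_pow, hr2, Complex.I_sq]
      push_cast
      ring
    have hpi : (Real.pi : ℂ) ≠ 0 := by exact_mod_cast Real.pi_ne_zero
    have hcd : (1 / (-Complex.I * Real.pi)) * (1 / (Complex.I * Real.pi)) * (c ^ 2 * d ^ 2) =
        (1 : ℂ) := by
      rw [hc, hd]
      have := Complex.I_ne_zero
      push_cast
      field_simp
      simp
    rw [e, Complex.exp_add, Complex.exp_add, Complex.exp_add]
    linear_combination (Complex.exp (((1 : ℝ) : ℂ) * Complex.I * ((A + B + C + D) / r) ^ 2 / 4) *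
      (Complex.exp (((1 : ℝ) : ℂ) * Complex.I * (Complex.I * (A + B - C - D) / r) ^ 2 / 4) *
      (Complex.exp (((-1 : ℝ) : ℂ) * Complex.I * ((A - B + C - D) / r) ^ 2 / 4) *
      Complex.exp (((-1 : ℝ) : ℂ) * Complex.I *
        (Complex.I * (A - B - C + D) / r) ^ 2 / 4)))) * hcd
  rw [← hval]
  refine ⟨hint.congr (.of_forall fun p => ?_), integral_congr_ae (.of_forall fun p => ?_)⟩
  · exact (contour_product_eq A B C D r ε p.1 p.2.1 p.2.2.1 p.2.2.2).symm
  · exact contour_product_eq A B C D r ε p.1 p.2.1 p.2.2.1 p.2.2.2
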